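/- Let p = 2 and let F be a nonempty subset of P_2(ℝ) that is displacement convex and closed with respect to W_2, and let proj_F μ denote the unique minimizer of ν ↦ W_2(ν, μ) over F. Then proj_F is 1-Lipschitz: for all μ, ν ∈ P_2(ℝ), W_2(proj_F μ, proj_F ν) ≤ W_2(μ, ν). -/

import Mathlib

open MeasureTheory Set Filter

noncomputable def quantile (μ : MeasureTheory.Measure ℝ) (u : ℝ) : ℝ :=
  sInf {x : ℝ | u ≤ (μ (Set.Iic x)).toReal}

def HasFiniteMomentP (p : ℝ) (μ : MeasureTheory.Measure ℝ) : Prop :=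
  MeasureTheory.IsProbabilityMeasure μ ∧
    MeasureTheory.Integrable (fun x => |x| ^ p) μ

noncomputable def Wdist (p : ℝ) (μ ν : MeasureTheory.Measure ℝ) : ℝ :=
  (∫ u in Set.Ioo (0:ℝ) 1, |quantile μ u - quantile ν u| ^ p) ^ (1 / p)

def DisplacementConvex (F : Set (MeasureTheory.Measure ℝ)) : Prop :=
  ∀ μ ∈ F, ∀ ν ∈ F, ∀ t ∈ Set.Icc (0:ℝ) 1, ∃ σ ∈ F,
    ∀ u ∈ Set.Ioo (0:ℝ) 1,
      quantile σ u = (1 - t) * quantile μ u + t * quantile ν u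

def WClosed (p : ℝ) (F : Set (MeasureTheory.Measure ℝ)) : Prop :=
  ∀ (μs : ℕ → MeasureTheory.Measure ℝ) (μ : MeasureTheory.Measure ℝ),
    (∀ n, μs n ∈ F) → HasFiniteMomentP p μ →
    Filter.Tendsto (fun n => Wdist p (μs n) μ) Filter.atTop (nhds 0) → μ ∈ F

open ProbabilityTheory Topology in
lemma quantile_le_iff (μ : Measure ℝ) [IsProbabilityMeasure μ] {u : ℝ} (hu : u ∈ Ioo (0 : ℝ) 1)
    (x : ℝ) : quantile μ u ≤ x ↔ u ≤ cdf μ x := by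
  have hq : quantile μ u = sInf {x : ℝ | u ≤ cdf μ x} := by
    simp only [cdf_eq_real, quantile, measureReal_def]
  have hne : {x : ℝ | u ≤ cdf μ x}.Nonempty :=
    ((tendsto_cdf_atTop μ).eventually (eventually_ge_nhds hu.2)).exists
  have hbdd : BddBelow {x : ℝ | u ≤ cdf μ x} := by
    obtain ⟨b, hb⟩ := ((tendsto_cdf_atBot μ).eventually (eventually_lt_nhds hu.1)).exists
    refine ⟨b, fun y hy => ?_⟩
    by_contra! hyb
    exact absurd (hy.trans (monotone_cdf μ hyb.le)) hb.not_ge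
  rw [hq]
  refine ⟨fun h => ?_, fun h => csInf_le hbdd h⟩
  have hright : Tendsto (cdf μ) (𝓝[>] x) (𝓝 (cdf μ x)) :=
    ((cdf μ).right_continuous x).mono_left (nhdsWithin_mono x Ioi_subset_Ici_self)
  refine ge_of_tendsto hright ?_
  filter_upwards [self_mem_nhdsWithin] with y hy
  obtain ⟨z, hz, hzy⟩ := exists_lt_of_csInf_lt hne (h.trans_lt hy)
  exact hz.trans (monotone_cdf μ hzy.le)

lemma monotoneOn_quantile (μ : Measure ℝ) [IsProbabilityMeasure μ] :
    MonotoneOn (quantile μ) (Ioo 0 1) := fun _ hu _ hv huv =>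
  (quantile_le_iff μ hu _).2 (huv.trans ((quantile_le_iff μ hv _).1 le_rfl))

lemma aemeasurable_quantile (μ : Measure ℝ) [IsProbabilityMeasure μ] :
    AEMeasurable (quantile μ) (volume.restrict (Ioo 0 1)) :=
  aemeasurable_restrict_of_monotoneOn measurableSet_Ioo (monotoneOn_quantile μ)

open ProbabilityTheory in
lemma map_quantile (μ : Measure ℝ) [IsProbabilityMeasure μ] :
    (volume.restrict (Ioo 0 1)).map (quantile μ) = μ := by
  refine Measure.ext_of_Iic _ _ fun x => ?_
  have hset : quantile μ ⁻¹' Iic x ∩ Ioo 0 1 = Iic (cdf μ x) ∩ Ioo 0 1 := by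
    ext u
    exact and_congr_left (quantile_le_iff μ · x)
  have hvol : volume (Iic (cdf μ x) ∩ Ioo 0 1) = ENNReal.ofReal (cdf μ x) := by
    rw [measure_congr ((ae_eq_refl _).inter Ioo_ae_eq_Ioc), inter_comm, Ioc_inter_Iic,
      min_eq_right (cdf_le_one μ x), Real.volume_Ioc, sub_zero]
  rw [Measure.map_apply_of_aemeasurable (aemeasurable_quantile μ) measurableSet_Iic,
    Measure.restrict_apply' measurableSet_Ioo, hset, hvol, ofReal_cdf]

lemma memLp_quantile {μ : Measure ℝ} (hμ : HasFiniteMomentP 2 μ) :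
    MemLp (quantile μ) 2 (volume.restrict (Ioo 0 1)) := by
  obtain ⟨_, hint⟩ := hμ
  have hid : MemLp id 2 μ := by
    refine (memLp_two_iff_integrable_sq aestronglyMeasurable_id).2 ?_
    simpa using hint
  rw [← map_quantile μ] at hid
  exact (memLp_map_measure_iff aestronglyMeasurable_id (aemeasurable_quantile μ)).1 hid

lemma Wdist_two_eq_norm {μ ν : Measure ℝ} (hμ : HasFiniteMomentP 2 μ)
    (hν : HasFiniteMomentP 2 ν) :
    Wdist 2 μ ν = ‖(memLp_quantile hμ).toLp - (memLp_quantile hν).toLp‖ := by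
  rw [← MemLp.toLp_sub, Lp.norm_toLp,
    ((memLp_quantile hμ).sub (memLp_quantile hν)).eLpNorm_eq_integral_rpow_norm (by simp) (by simp),
    ENNReal.toReal_ofReal (by positivity)]
  simp [Wdist]

lemma real_inner_sub_nonpos_of_forall_norm_sub_le {E : Type*} [NormedAddCommGroup E]
    [InnerProductSpace ℝ E] {x a b : E} (h : ∀ c ∈ segment ℝ a b, ‖x - a‖ ≤ ‖x - c‖) :
    inner ℝ (x - a) (b - a) ≤ 0 := by
  refine (norm_eq_iInf_iff_real_inner_le_zero (convex_segment a b)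
    (left_mem_segment ℝ a b)).1 ?_ b (right_mem_segment ℝ a b)
  have : Nonempty (segment ℝ a b) := ⟨⟨a, left_mem_segment ℝ a b⟩⟩
  exact le_antisymm (le_ciInf fun c => h c c.2)
    (ciInf_le ⟨0, by rintro _ ⟨c, rfl⟩; positivity⟩
      (⟨a, left_mem_segment ℝ a b⟩ : segment ℝ a b))

lemma norm_sub_le_of_real_inner_nonpos {E : Type*} [NormedAddCommGroup E]
    [InnerProductSpace ℝ E] {x y a b : E} (ha : inner ℝ (x - a) (b - a) ≤ 0)
    (hb : inner ℝ (y - b) (a - b) ≤ 0) : ‖a - b‖ ≤ ‖x - y‖ := by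
  have key : ‖a - b‖ * ‖a - b‖ ≤ ‖x - y‖ * ‖a - b‖ := by
    refine le_trans ?_ (real_inner_le_norm (x - y) (a - b))
    rw [← real_inner_self_eq_norm_mul_norm]
    simp only [inner_sub_left, inner_sub_right] at *
    linarith
  by_contra! hlt
  exact absurd (le_of_mul_le_mul_right key ((norm_nonneg _).trans_lt hlt)) hlt.not_ge

lemma real_inner_quantile_nonpos {F : Set (Measure ℝ)} (hFmom : ∀ ρ ∈ F, HasFiniteMomentP 2 ρ)
    (hconv : DisplacementConvex F) {μ α β : Measure ℝ} (hμ : HasFiniteMomentP 2 μ)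
    (hα : α ∈ F) (hmin : ∀ ρ ∈ F, Wdist 2 α μ ≤ Wdist 2 ρ μ) (hβ : β ∈ F) :
    inner ℝ ((memLp_quantile hμ).toLp - (memLp_quantile (hFmom α hα)).toLp)
      ((memLp_quantile (hFmom β hβ)).toLp - (memLp_quantile (hFmom α hα)).toLp) ≤ 0 := by
  refine real_inner_sub_nonpos_of_forall_norm_sub_le ?_
  rw [segment_eq_image]
  rintro _ ⟨t, ht, rfl⟩
  obtain ⟨σ, hσ, hq⟩ := hconv α hα β hβ t ht
  have heq : (memLp_quantile (hFmom σ hσ)).toLp = (1 - t) • (memLp_quantile (hFmom α hα)).toLp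
      + t • (memLp_quantile (hFmom β hβ)).toLp := by
    rw [← MemLp.toLp_const_smul, ← MemLp.toLp_const_smul, ← MemLp.toLp_add]
    refine MemLp.toLp_congr _ _ ?_
    filter_upwards [ae_restrict_mem measurableSet_Ioo] with u hu
    simpa using hq u hu
  have hle := hmin σ hσ
  rw [Wdist_two_eq_norm (hFmom α hα) hμ, Wdist_two_eq_norm (hFmom σ hσ) hμ, heq] at hle
  rwa [norm_sub_rev, norm_sub_rev _ (_ + _)]

/-- Theorem 2.8, Lipschitz property for `p = 2`.
If `F ⊆ P_2(ℝ)` is nonempty, displacement convex and `W_2`-closed, then the projection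
`proj_F` is 1-Lipschitz: whenever `μhat` is a minimizer of `ρ ↦ W_2(ρ, μ)` over `F` and
`νhat` is a minimizer of `ρ ↦ W_2(ρ, ν)` over `F` (the minimizers being unique), we have
`W_2(μhat, νhat) ≤ W_2(μ, ν)`. -/
theorem wasserstein_projection_lipschitz
    (F : Set (MeasureTheory.Measure ℝ)) (hne : F.Nonempty)
    (hFmom : ∀ ρ ∈ F, HasFiniteMomentP 2 ρ)
    (hconv : DisplacementConvex F)
    (hclosed : WClosed 2 F)
    (μ ν : MeasureTheory.Measure ℝ)
    (hμ : HasFiniteMomentP 2 μ) (hν : HasFiniteMomentP 2 ν)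
    (μhat νhat : MeasureTheory.Measure ℝ)
    (hμhatF : μhat ∈ F) (hμhatmin : ∀ ρ ∈ F, Wdist 2 μhat μ ≤ Wdist 2 ρ μ)
    (hνhatF : νhat ∈ F) (hνhatmin : ∀ ρ ∈ F, Wdist 2 νhat ν ≤ Wdist 2 ρ ν) :
    Wdist 2 μhat νhat ≤ Wdist 2 μ ν := by
  rw [Wdist_two_eq_norm (hFmom μhat hμhatF) (hFmom νhat hνhatF), Wdist_two_eq_norm hμ hν]
  exact norm_sub_le_of_real_inner_nonpos
    (real_inner_quantile_nonpos hFmom hconv hμ hμhatF hμhatmin hνhatF)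
    (real_inner_quantile_nonpos hFmom hconv hν hνhatF hνhatmin hμhatF)
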